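/- The function φ(a,b) = S(a,b) − N(a,b) is convex on (0,∞)², where S is the root-mean-square and N the Heronian mean. -/

import Mathlib

noncomputable def meanA (a b : ℝ) : ℝ := (a + b) / 2
noncomputable def meanG (a b : ℝ) : ℝ := Real.sqrt (a * b)
noncomputable def meanH (a b : ℝ) : ℝ := 2 * a * b / (a + b)
noncomputable def meanN (a b : ℝ) : ℝ := (a + Real.sqrt (a * b) + b) / 3
noncomputable def meanC (a b : ℝ) : ℝ := (a ^ 2 + b ^ 2) / (a + b)
noncomputable def meanS (a b : ℝ) : ℝ := Real.sqrt ((a ^ 2 + b ^ 2) / 2)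
noncomputable def meanR (a b : ℝ) : ℝ := 2 * (a ^ 2 + a * b + b ^ 2) / (3 * (a + b))
noncomputable def triDelta (a b : ℝ) : ℝ := (a - b) ^ 2 / (a + b)
noncomputable def hellinger (a b : ℝ) : ℝ := (Real.sqrt a - Real.sqrt b) ^ 2 / 2

theorem stmt_5 :
    ConvexOn ℝ (Set.Ioi (0 : ℝ) ×ˢ Set.Ioi (0 : ℝ))
      (fun p : ℝ × ℝ => meanS p.1 p.2 - meanN p.1 p.2) := by
  refine ⟨(convex_Ioi 0).prod (convex_Ioi 0), ?_⟩
  rintro ⟨a, b⟩ ⟨ha, hb⟩ ⟨c, d⟩ ⟨hc, hd⟩ t s ht hs hts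
  simp only [Set.mem_Ioi] at ha hb hc hd
  simp only [meanS, meanN, Prod.smul_mk, Prod.mk_add_mk, smul_eq_mul]
  have hX0 := Real.sqrt_nonneg ((a ^ 2 + b ^ 2) / 2)
  have hY0 := Real.sqrt_nonneg ((c ^ 2 + d ^ 2) / 2)
  have hX := Real.sq_sqrt (show 0 ≤ (a ^ 2 + b ^ 2) / 2 by positivity)
  have hY := Real.sq_sqrt (show 0 ≤ (c ^ 2 + d ^ 2) / 2 by positivity)
  have hP0 := Real.sqrt_nonneg (a * b)
  have hQ0 := Real.sqrt_nonneg (c * d)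
  have hP := Real.sq_sqrt (show 0 ≤ a * b by positivity)
  have hQ := Real.sq_sqrt (show 0 ≤ c * d by positivity)
  set X := √((a ^ 2 + b ^ 2) / 2)
  set Y := √((c ^ 2 + d ^ 2) / 2)
  set P := √(a * b)
  set Q := √(c * d)
  have h1 : (a * c + b * d) / 2 ≤ X * Y := by
    refine le_of_abs_le (abs_le_of_sq_le_sq ?_ (by positivity))
    rw [mul_pow, hX, hY]
    nlinarith [sq_nonneg (a * d - b * c)]
  have h2 : P * Q ≤ (a * d + b * c) / 2 := by
    refine le_of_abs_le (abs_le_of_sq_le_sq ?_ (by positivity))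
    rw [mul_pow, hP, hQ]
    nlinarith [sq_nonneg (a * d - b * c)]
  have hS : √(((t * a + s * c) ^ 2 + (t * b + s * d) ^ 2) / 2) ≤ t * X + s * Y := by
    apply Real.sqrt_le_iff.2 ⟨by positivity, ?_⟩
    have e : (t * X + s * Y) ^ 2 = t ^ 2 * X ^ 2 + s ^ 2 * Y ^ 2 + 2 * (t * s) * (X * Y) := by ring
    rw [e, hX, hY]
    nlinarith [mul_le_mul_of_nonneg_left h1 (mul_nonneg ht hs)]
  have hG : t * P + s * Q ≤ √((t * a + s * c) * (t * b + s * d)) := by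
    apply Real.le_sqrt_of_sq_le
    have e : (t * P + s * Q) ^ 2 = t ^ 2 * P ^ 2 + s ^ 2 * Q ^ 2 + 2 * (t * s) * (P * Q) := by ring
    rw [e, hP, hQ]
    nlinarith [mul_le_mul_of_nonneg_left h2 (mul_nonneg ht hs)]
  linarith
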